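/- Quantitative closeness of the LAS and the semi-discrete Lagrangian scheme. Let V be a probability vector field satisfying (H1) and (H3), and μ₀ ∈ 𝒫_c(ℝ^d). Let μ^N be the Lattice Approximate Solution and μ̄^N the semi-discrete Lagrangian scheme with initial datum μ₀ and the same time step Δt^N = T/N. Then sup_{t∈[0,T]} W(μ^N_t, μ̄^N_t) → 0 as N → +∞. -/

import Mathlib

open MeasureTheory Set Filter Topology Metric
open scoped ENNReal NNReal Classical

noncomputable section

abbrev Euc (d : ℕ) : Type := EuclideanSpace ℝ (Fin d)

/-- The (topological) support of a measure. -/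
def msupp {X : Type*} [TopologicalSpace X] [MeasurableSpace X] (μ : Measure X) : Set X :=
  {x | ∀ U : Set X, IsOpen U → x ∈ U → 0 < μ U}

/-- Compactly supported Borel probability measures (membership in `𝒫_c`). -/
def Pc {X : Type*} [TopologicalSpace X] [MeasurableSpace X] (μ : Measure X) : Prop :=
  IsProbabilityMeasure μ ∧ ∃ K : Set X, IsCompact K ∧ μ Kᶜ = 0

/-- A probability vector field: `π₁ ♯ V[μ] = μ`. -/
def IsPVF {d : ℕ} (V : Measure (Euc d) → Measure (Euc d × Euc d)) : Prop :=
  ∀ μ : Measure (Euc d), IsProbabilityMeasure μ →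
    IsProbabilityMeasure (V μ) ∧ (V μ).map Prod.fst = μ

/-- Solution of the measure differential equation `μ̇_t = V[μ_t]` on `[0,T]`. -/
def IsMDESol {d : ℕ} (T : ℝ) (V : Measure (Euc d) → Measure (Euc d × Euc d))
    (μ : ℝ → Measure (Euc d)) : Prop :=
  ∀ f : Euc d → ℝ, ContDiff ℝ (⊤ : ℕ∞) f → HasCompactSupport f →
    IntegrableOn (fun t => ∫ p : Euc d × Euc d, fderiv ℝ f p.1 p.2 ∂(V (μ t))) (Icc 0 T) ∧
    ∀ t ∈ Icc (0 : ℝ) T,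
      (∫ x, f x ∂(μ t)) - (∫ x, f x ∂(μ 0)) =
        ∫ s in Icc (0 : ℝ) t, (∫ p : Euc d × Euc d, fderiv ℝ f p.1 p.2 ∂(V (μ s)))

/-- 1-Wasserstein distance via the Kantorovich–Rubinstein duality. -/
def W1 {X : Type*} [MeasurableSpace X] [PseudoMetricSpace X] (μ ν : Measure X) : ℝ :=
  ⨆ f : {f : X → ℝ // LipschitzWith 1 f}, ((∫ x, f.1 x ∂μ) - ∫ x, f.1 x ∂ν)

/-- Disintegration `ν_x[·]` of a measure on a product space w.r.t. the first projection. -/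
def disint {d : ℕ} (m : Measure (Euc d × Euc d)) : Euc d → Measure (Euc d) :=
  if h : IsFiniteMeasure m then
    haveI := h
    fun x => m.condKernel x
  else fun _ => 0

/-- Barycenter of the disintegration: `x ↦ ∫ v dν_x(v)`. -/
def bary {d : ℕ} (m : Measure (Euc d × Euc d)) (x : Euc d) : Euc d :=
  ∫ v, v ∂(disint m x)


section Hypotheses

/-- Condition (H1) with a given constant `C`. -/
def H1cond {d : ℕ} (C : ℝ) (V : Measure (Euc d) → Measure (Euc d × Euc d)) : Prop :=
  ∀ μ : Measure (Euc d), Pc μ →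
    ∀ p ∈ msupp (V μ), ‖p.2‖ ≤ C * (1 + ⨆ x : msupp μ, ‖(x : Euc d)‖)

/-- Hypothesis (H1): sublinearity of the PVF. -/
def H1 {d : ℕ} (V : Measure (Euc d) → Measure (Euc d × Euc d)) : Prop :=
  ∃ C > 0, H1cond C V

/-- Hypothesis (H2): continuity of the PVF `V : 𝒫_c(ℝ^d) → 𝒫_c(Tℝ^d)` w.r.t. Wasserstein. -/
def H2 {d : ℕ} (V : Measure (Euc d) → Measure (Euc d × Euc d)) : Prop :=
  (∀ μ, Pc μ → Pc (V μ)) ∧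
  ∀ μ, Pc μ → ∀ ε > 0, ∃ δ > 0, ∀ ν, Pc ν → W1 μ ν < δ → W1 (V μ) (V ν) < ε

/-- Transference plans between two measures. -/
def Couplings {X Y : Type*} [MeasurableSpace X] [MeasurableSpace Y]
    (μ : Measure X) (ν : Measure Y) : Set (Measure (X × Y)) :=
  {π | π.map Prod.fst = μ ∧ π.map Prod.snd = ν}

/-- 1-Wasserstein distance as infimum over transference plans. -/
def Wplan {X : Type*} [MeasurableSpace X] [PseudoMetricSpace X] (μ ν : Measure X) : ℝ :=
  sInf ((fun π : Measure (X × X) => ∫ p, dist p.1 p.2 ∂π) '' Couplings μ ν)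

/-- Optimal transference plans. -/
def OptCouplings {X : Type*} [MeasurableSpace X] [PseudoMetricSpace X] (μ ν : Measure X) :
    Set (Measure (X × X)) :=
  {π | π ∈ Couplings μ ν ∧ (∫ p, dist p.1 p.2 ∂π) = Wplan μ ν}

/-- The quantity `𝒲(V₁,V₂)`: minimal fiber displacement over plans whose base marginal is
an optimal plan between the two base measures. -/
def Wfib {d : ℕ} (V₁ V₂ : Measure (Euc d × Euc d)) : ℝ :=
  sInf ((fun P : Measure ((Euc d × Euc d) × (Euc d × Euc d)) => ∫ q, ‖q.1.2 - q.2.2‖ ∂P) ''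
    {P | P ∈ Couplings V₁ V₂ ∧
      P.map (fun q => (q.1.1, q.2.1)) ∈ OptCouplings (V₁.map Prod.fst) (V₂.map Prod.fst)})

/-- Hypothesis (H3): local Lipschitz continuity of the PVF in the `μ` variable. -/
def H3 {d : ℕ} (V : Measure (Euc d) → Measure (Euc d × Euc d)) : Prop :=
  ∀ R > 0, ∃ L > 0, ∀ μ ν : Measure (Euc d), Pc μ → Pc ν →
    msupp μ ⊆ ball (0 : Euc d) R → msupp ν ⊆ ball (0 : Euc d) R →
    Wfib (V μ) (V ν) ≤ L * W1 μ ν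

end Hypotheses

section Schemes

/-- The semi-discrete (in time) Lagrangian scheme at grid times `t_k = k T/N`. -/
def lagrStep {d : ℕ} (T : ℝ) (N : ℕ) (V : Measure (Euc d) → Measure (Euc d × Euc d))
    (μ₀ : Measure (Euc d)) : ℕ → Measure (Euc d)
  | 0 => μ₀
  | k + 1 => (V (lagrStep T N V μ₀ k)).map fun p => p.1 + (T / N) • p.2

/-- Time interpolation of the semi-discrete Lagrangian scheme. -/
def lagrT {d : ℕ} (T : ℝ) (N : ℕ) (V : Measure (Euc d) → Measure (Euc d × Euc d))
    (μ₀ : Measure (Euc d)) (t : ℝ) : Measure (Euc d) :=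
  if t ≤ 0 then μ₀
  else
    (V (lagrStep T N V μ₀ (⌈t / (T / N)⌉.toNat - 1))).map fun p =>
      p.1 + (t - (↑(⌈t / (T / N)⌉.toNat - 1) : ℝ) * (T / N)) • p.2

/-- The mean velocity scheme at grid times `t_j = j T/N`. -/
def mvelStep {d : ℕ} (T : ℝ) (N : ℕ) (V : Measure (Euc d) → Measure (Euc d × Euc d))
    (μ₀ : Measure (Euc d)) : ℕ → Measure (Euc d)
  | 0 => μ₀
  | j + 1 => (mvelStep T N V μ₀ j).map fun x =>
      x + (T / N) • bary (V (mvelStep T N V μ₀ j)) x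

/-- Time interpolation of the mean velocity scheme. -/
def mvelT {d : ℕ} (T : ℝ) (N : ℕ) (V : Measure (Euc d) → Measure (Euc d × Euc d))
    (μ₀ : Measure (Euc d)) (t : ℝ) : Measure (Euc d) :=
  if t ≤ 0 then μ₀
  else
    (mvelStep T N V μ₀ (⌈t / (T / N)⌉.toNat - 1)).map fun x =>
      x + (t - (↑(⌈t / (T / N)⌉.toNat - 1) : ℝ) * (T / N)) •
        bary (V (mvelStep T N V μ₀ (⌈t / (T / N)⌉.toNat - 1))) x

end Schemes

section LAS

variable {d : ℕ}

/-- Space grid point (as a function), `x_i = Δ_N^x · i`. -/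
def gx (T : ℝ) (N : ℕ) (i : Fin d → ℤ) (k : Fin d) : ℝ := (T / N ^ 2) * i k

/-- Velocity grid point (as a function), `v_j = Δ_N^v · j`. -/
def gv (N : ℕ) (j : Fin d → ℤ) (k : Fin d) : ℝ := (1 / N) * j k

/-- Space grid point as an element of `ℝ^d`. -/
def gxE (T : ℝ) (N : ℕ) (i : Fin d → ℤ) : Euc d :=
  (EuclideanSpace.equiv (Fin d) ℝ).symm (gx T N i)

/-- Velocity grid point as an element of `ℝ^d`. -/
def gvE (N : ℕ) (j : Fin d → ℤ) : Euc d :=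
  (EuclideanSpace.equiv (Fin d) ℝ).symm (gv N j)

/-- The space grid constraint `x_i ∈ [-N,N]^d`. -/
def okX (T : ℝ) (N : ℕ) (i : Fin d → ℤ) : Prop := ∀ k, |gx T N i k| ≤ N

/-- The velocity grid constraint `v_j ∈ [-TN,TN]^d`. -/
def okV (T : ℝ) (N : ℕ) (j : Fin d → ℤ) : Prop := ∀ k, |gv N j k| ≤ T * N

/-- The cube `x_i + [0, Δ_N^x)^d`. -/
def boxX (T : ℝ) (N : ℕ) (i : Fin d → ℤ) : Set (Euc d) :=
  {y | ∀ k, gx T N i k ≤ y k ∧ y k < gx T N i k + T / N ^ 2}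

/-- The cube `v_j + [0, Δ_N^v)^d`. -/
def boxV (N : ℕ) (j : Fin d → ℤ) : Set (Euc d) :=
  {v | ∀ k, gv N j k ≤ v k ∧ v k < gv N j k + 1 / N}

/-- The mass `m_i^x(μ) = μ(x_i + [0,Δ_N^x)^d)`. -/
def mxc (T : ℝ) (N : ℕ) (μ : Measure (Euc d)) (i : Fin d → ℤ) : ℝ≥0∞ := μ (boxX T N i)

/-- The mass `m_{ij}^v(W) = W({(x_i,v) : v ∈ v_j + [0,Δ_N^v)^d})`. -/
def mvc (T : ℝ) (N : ℕ) (W : Measure (Euc d × Euc d)) (i j : Fin d → ℤ) : ℝ≥0∞ :=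
  W ({gxE T N i} ×ˢ boxV N j)

/-- The space discretization operator `𝒜_N^x`. -/
def Ax (T : ℝ) (N : ℕ) (μ : Measure (Euc d)) : Measure (Euc d) :=
  Measure.sum fun i : Fin d → ℤ =>
    if okX T N i then mxc T N μ i • Measure.dirac (gxE T N i) else 0

/-- The Lattice Approximate Solution at grid times `kΔ_N`. -/
def LASk (T : ℝ) (N : ℕ) (V : Measure (Euc d) → Measure (Euc d × Euc d))
    (μ₀ : Measure (Euc d)) : ℕ → Measure (Euc d)
  | 0 => Ax T N μ₀
  | k + 1 =>
      Measure.sum fun ij : (Fin d → ℤ) × (Fin d → ℤ) =>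
        if okX T N ij.1 ∧ okV T N ij.2 then
          mvc T N (V (LASk T N V μ₀ k)) ij.1 ij.2 •
            Measure.dirac (gxE T N ij.1 + (T / N) • gvE N ij.2)
        else 0

/-- The (time-interpolated) Lattice Approximate Solution. -/
def LAS (T : ℝ) (N : ℕ) (V : Measure (Euc d) → Measure (Euc d × Euc d))
    (μ₀ : Measure (Euc d)) (t : ℝ) : Measure (Euc d) :=
  if t ≤ 0 then LASk T N V μ₀ 0
  else
    Measure.sum fun ij : (Fin d → ℤ) × (Fin d → ℤ) =>
      if okX T N ij.1 ∧ okV T N ij.2 then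
        mvc T N (V (LASk T N V μ₀ (⌈t / (T / N)⌉.toNat - 1))) ij.1 ij.2 •
          Measure.dirac (gxE T N ij.1 +
            (t - (↑(⌈t / (T / N)⌉.toNat - 1) : ℝ) * (T / N)) • gvE N ij.2)
      else 0

end LAS


open scoped ProbabilityTheory

section Plans

/-- Gluing lemma: a plan between the base marginals lifts to a plan between the fibred measures. -/
theorem exists_coupling_lift {X Y F G : Type*} [MeasurableSpace X] [MeasurableSpace Y]
    [MeasurableSpace F] [MeasurableSpace G] [StandardBorelSpace F] [Nonempty F]
    [StandardBorelSpace G] [Nonempty G] (V₁ : Measure (X × F)) (V₂ : Measure (Y × G))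
    [IsProbabilityMeasure V₁] [IsProbabilityMeasure V₂] (π : Measure (X × Y))
    (hπ : π ∈ Couplings (V₁.map Prod.fst) (V₂.map Prod.fst)) :
    ∃ P ∈ Couplings V₁ V₂, P.map (fun q => (q.1.1, q.2.1)) = π := by
  obtain ⟨h₁, h₂⟩ := hπ
  have : IsProbabilityMeasure (V₁.map Prod.fst) :=
    Measure.isProbabilityMeasure_map measurable_fst.aemeasurable
  have : IsProbabilityMeasure π := by
    rw [← h₁] at this
    exact Measure.isProbabilityMeasure_of_map Prod.fst
  let κ : ProbabilityTheory.Kernel (X × Y) (F × G) :=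
    (V₁.condKernel.comap Prod.fst measurable_fst) ×ₖ (V₂.condKernel.comap Prod.snd measurable_snd)
  let g : (X × Y) × (F × G) → (X × F) × (Y × G) := fun z => ((z.1.1, z.2.1), (z.1.2, z.2.2))
  have hg : Measurable g := by fun_prop
  refine ⟨(π ⊗ₘ κ).map g, ⟨?_, ?_⟩, ?_⟩
  · rw [Measure.map_map measurable_fst hg]
    ext s hs
    rw [Measure.map_apply (measurable_fst.comp hg) hs,
      Measure.compProd_apply (hs.preimage (measurable_fst.comp hg))]
    conv_rhs => rw [← V₁.disintegrate V₁.condKernel, Measure.compProd_apply hs, Measure.fst, ← h₁]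
    rw [lintegral_map (ProbabilityTheory.Kernel.measurable_kernel_prodMk_left hs) measurable_fst]
    refine lintegral_congr fun a => ?_
    have : Prod.mk a ⁻¹' (Prod.fst ∘ g ⁻¹' s) = (Prod.mk a.1 ⁻¹' s) ×ˢ (univ : Set G) := by
      ext z; simp [g]
    rw [this, ProbabilityTheory.Kernel.prod_apply_prod]
    simp [ProbabilityTheory.Kernel.comap_apply]
  · rw [Measure.map_map measurable_snd hg]
    ext s hs
    rw [Measure.map_apply (measurable_snd.comp hg) hs,
      Measure.compProd_apply (hs.preimage (measurable_snd.comp hg))]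
    conv_rhs => rw [← V₂.disintegrate V₂.condKernel, Measure.compProd_apply hs, Measure.fst, ← h₂]
    rw [lintegral_map (ProbabilityTheory.Kernel.measurable_kernel_prodMk_left hs) measurable_snd]
    refine lintegral_congr fun a => ?_
    have : Prod.mk a ⁻¹' (Prod.snd ∘ g ⁻¹' s) = (univ : Set F) ×ˢ (Prod.mk a.2 ⁻¹' s) := by
      ext z; simp [g]
    rw [this, ProbabilityTheory.Kernel.prod_apply_prod]
    simp [ProbabilityTheory.Kernel.comap_apply]
  · rw [Measure.map_map (by fun_prop) hg]
    exact Measure.fst_compProd π κ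

/-- A pair of random variables bounds the transport cost between their laws. -/
theorem Wplan_map_le {Ω X : Type*} [MeasurableSpace Ω] [PseudoMetricSpace X]
    [SecondCountableTopology X] [MeasurableSpace X] [BorelSpace X] (P : Measure Ω)
    {F G : Ω → X} (hF : Measurable F) (hG : Measurable G) :
    Wplan (P.map F) (P.map G) ≤ ∫ ω, dist (F ω) (G ω) ∂P := by
  refine csInf_le ⟨0, ?_⟩ ⟨P.map fun ω => (F ω, G ω), ⟨?_, ?_⟩, ?_⟩
  · rintro _ ⟨π, -, rfl⟩
    exact integral_nonneg fun _ => dist_nonneg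
  · rw [Measure.map_map measurable_fst (by fun_prop)]; rfl
  · rw [Measure.map_map measurable_snd (by fun_prop)]; rfl
  · exact integral_map (hF.prodMk hG).aemeasurable (measurable_dist.aestronglyMeasurable)

theorem ae_fst_of_map {X Y : Type*} [MeasurableSpace X] [MeasurableSpace Y] {π : Measure (X × Y)}
    {μ : Measure X} (h : π.map Prod.fst = μ) {p : X → Prop} (hp : ∀ᵐ x ∂μ, p x) :
    ∀ᵐ z ∂π, p z.1 :=
  ae_of_ae_map measurable_fst.aemeasurable (h ▸ hp)

theorem ae_snd_of_map {X Y : Type*} [MeasurableSpace X] [MeasurableSpace Y] {π : Measure (X × Y)}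
    {ν : Measure Y} (h : π.map Prod.snd = ν) {p : Y → Prop} (hp : ∀ᵐ x ∂ν, p x) :
    ∀ᵐ z ∂π, p z.2 :=
  ae_of_ae_map measurable_snd.aemeasurable (h ▸ hp)

theorem isProbabilityMeasure_of_map_fst {X Y : Type*} [MeasurableSpace X] [MeasurableSpace Y]
    {π : Measure (X × Y)} {μ : Measure X} [IsProbabilityMeasure μ] (h : π.map Prod.fst = μ) :
    IsProbabilityMeasure π := by
  have : IsProbabilityMeasure (π.map Prod.fst) := h ▸ inferInstance
  exact Measure.isProbabilityMeasure_of_map Prod.fst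

variable {E : Type*} [NormedAddCommGroup E] [MeasurableSpace E] [BorelSpace E]
  [SecondCountableTopology E]

/-- The easy half of Kantorovich–Rubinstein duality, for boundedly concentrated measures. -/
theorem W1_le_Wplan {μ ν : Measure E} [IsProbabilityMeasure μ] [IsProbabilityMeasure ν] {r : ℝ}
    (hμ : ∀ᵐ x ∂μ, ‖x‖ ≤ r) (hν : ∀ᵐ x ∂ν, ‖x‖ ≤ r) : W1 μ ν ≤ Wplan μ ν := by
  have : Nonempty {f : E → ℝ // LipschitzWith 1 f} := ⟨⟨fun _ => 0, LipschitzWith.const' 0⟩⟩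
  refine ciSup_le fun ⟨f, hf⟩ => le_csInf ?_ ?_
  · exact ⟨_, μ.prod ν, ⟨by simp, by simp⟩, rfl⟩
  · rintro _ ⟨π, ⟨h₁, h₂⟩, rfl⟩
    have := isProbabilityMeasure_of_map_fst h₁
    have key : ∀ x : E, ‖x‖ ≤ r → ‖f x‖ ≤ ‖f 0‖ + r := fun x hx => by
      have h := hf.dist_le_mul x 0
      rw [dist_eq_norm, dist_zero_right] at h
      have := norm_le_norm_add_norm_sub' (f x) (f 0)
      simp only [NNReal.coe_one, one_mul] at h
      linarith
    have hb₁ : ∀ᵐ z ∂π, ‖z.1‖ ≤ r := ae_fst_of_map h₁ hμ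
    have hb₂ : ∀ᵐ z ∂π, ‖z.2‖ ≤ r := ae_snd_of_map h₂ hν
    have hfm := hf.continuous.measurable
    have i₁ : Integrable (fun z : E × E => f z.1) π :=
      .of_bound (hfm.comp measurable_fst).aestronglyMeasurable (‖f 0‖ + r)
        (hb₁.mono fun z hz => key _ hz)
    have i₂ : Integrable (fun z : E × E => f z.2) π :=
      .of_bound (hfm.comp measurable_snd).aestronglyMeasurable (‖f 0‖ + r)
        (hb₂.mono fun z hz => key _ hz)
    have i₃ : Integrable (fun z : E × E => dist z.1 z.2) π := by
      refine .of_bound measurable_dist.aestronglyMeasurable (r + r) ?_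
      filter_upwards [hb₁, hb₂] with z hz₁ hz₂
      rw [Real.norm_of_nonneg dist_nonneg]
      exact (dist_le_norm_add_norm _ _).trans (add_le_add hz₁ hz₂)
    calc (∫ x, f x ∂μ) - ∫ x, f x ∂ν = (∫ z, f z.1 ∂π) - ∫ z, f z.2 ∂π := by
          rw [← h₁, ← h₂, integral_map measurable_fst.aemeasurable hfm.aestronglyMeasurable,
            integral_map measurable_snd.aemeasurable hfm.aestronglyMeasurable]
      _ = ∫ z, (f z.1 - f z.2) ∂π := (integral_sub i₁ i₂).symm
      _ ≤ ∫ z, dist z.1 z.2 ∂π := by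
          refine integral_mono (i₁.sub i₂) i₃ fun z => ?_
          have h := hf.dist_le_mul z.1 z.2
          simp only [NNReal.coe_one, one_mul, Real.dist_eq] at h
          exact (le_abs_self _).trans h

/-- Optimal plans exist between boundedly concentrated probability measures. -/
theorem exists_mem_optCouplings [ProperSpace E] {μ ν : Measure E} [IsProbabilityMeasure μ]
    [IsProbabilityMeasure ν] {r : ℝ} (hμ : ∀ᵐ x ∂μ, ‖x‖ ≤ r) (hν : ∀ᵐ x ∂ν, ‖x‖ ≤ r) :
    ∃ π, π ∈ OptCouplings μ ν := by
  let S : Set (ProbabilityMeasure (E × E)) := {π | (π : Measure (E × E)) ∈ Couplings μ ν}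
  have hS : S =
      (fun π => π.map measurable_fst.aemeasurable) ⁻¹' {(⟨μ, ‹_›⟩ : ProbabilityMeasure E)} ∩
      (fun π => π.map measurable_snd.aemeasurable) ⁻¹' {(⟨ν, ‹_›⟩ : ProbabilityMeasure E)} := by
    ext π
    exact ⟨fun h => ⟨Subtype.ext h.1, Subtype.ext h.2⟩,
      fun h => ⟨congrArg Subtype.val h.1, congrArg Subtype.val h.2⟩⟩
  have hcl : IsClosed S := by
    rw [hS]
    exact (isClosed_singleton.preimage (ProbabilityMeasure.continuous_map continuous_fst)).inter
      (isClosed_singleton.preimage (ProbabilityMeasure.continuous_map continuous_snd))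
  have hball : ∀ π ∈ S, ∀ᵐ z ∂(π : Measure (E × E)), z ∈ closedBall (0 : E) r ×ˢ closedBall 0 r := by
    intro π hπ
    filter_upwards [ae_fst_of_map hπ.1 hμ, ae_snd_of_map hπ.2 hν] with z h₁ h₂
    simpa using ⟨h₁, h₂⟩
  have hcomp : IsCompact S := by
    rw [← hcl.closure_eq]
    refine isCompact_closure_of_isTightMeasureSet ?_
    refine isTightMeasureSet_iff_exists_isCompact_measure_compl_le.2 fun ε _ =>
      ⟨closedBall 0 r ×ˢ closedBall 0 r,
        (isCompact_closedBall _ _).prod (isCompact_closedBall _ _), ?_⟩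
    rintro _ ⟨π, hπ, rfl⟩
    rw [show (π : Measure (E × E)) (closedBall 0 r ×ˢ closedBall 0 r)ᶜ = 0 from hball π hπ]
    exact zero_le
  have hne : S.Nonempty := ⟨⟨μ.prod ν, inferInstance⟩, ⟨by simp, by simp⟩⟩
  let c : BoundedContinuousFunction (E × E) ℝ :=
    BoundedContinuousFunction.ofNormedAddCommGroup (fun z => min (dist z.1 z.2) (|r| + |r|))
      (by fun_prop) (|r| + |r|) fun z => by
        rw [Real.norm_of_nonneg (le_min dist_nonneg (by positivity))]
        exact min_le_right _ _
  obtain ⟨π, hπ, hmin⟩ := hcomp.exists_isMinOn hne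
    (ProbabilityMeasure.continuous_integral_boundedContinuousFunction c).continuousOn
  have hc : ∀ π ∈ S, ∫ z, c z ∂(π : Measure (E × E)) = ∫ z, dist z.1 z.2 ∂(π : Measure (E × E)) := by
    intro π hπ
    refine integral_congr_ae ((hball π hπ).mono fun z hz => ?_)
    have hz' : ‖z.1‖ ≤ r ∧ ‖z.2‖ ≤ r := by simpa using hz
    refine min_eq_left ((dist_le_norm_add_norm _ _).trans ?_)
    exact add_le_add (hz'.1.trans (le_abs_self r)) (hz'.2.trans (le_abs_self r))
  refine ⟨π, hπ, le_antisymm ?_ ?_⟩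
  · refine le_csInf ⟨_, _, hπ, rfl⟩ ?_
    rintro _ ⟨π', hπ', rfl⟩
    have hp : IsProbabilityMeasure π' := isProbabilityMeasure_of_map_fst hπ'.1
    have h : ∫ z, c z ∂(π : Measure (E × E)) ≤ ∫ z, c z ∂π' := hmin (a := ⟨π', hp⟩) hπ'
    exact (hc π hπ).symm.le.trans (h.trans (hc ⟨π', hp⟩ hπ').le)
  · refine csInf_le ⟨0, ?_⟩ ⟨_, hπ, rfl⟩
    rintro _ ⟨π, -, rfl⟩
    exact integral_nonneg fun _ => dist_nonneg

end Plans

section Lattice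

/-- A sum of weighted Dirac masses over a countable index is the law of the indexed point. -/
theorem sum_dirac_eq_map {Ω ι X : Type*} [MeasurableSpace Ω] [MeasurableSpace ι]
    [MeasurableSpace X] [Countable ι] [MeasurableSingletonClass ι] {W : Measure Ω} {idx : Ω → ι}
    (hidx : Measurable idx) (G : ι → X) {ok : ι → Prop} [DecidablePred ok]
    (hok : ∀ᵐ ω ∂W, ok (idx ω)) {m : ι → ℝ≥0∞} (hm : ∀ i, ok i → m i = W (idx ⁻¹' {i})) :
    (Measure.sum fun i => if ok i then m i • Measure.dirac (G i) else 0) =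
      W.map fun ω => G (idx ω) := by
  have hG : Measurable G := measurable_of_countable G
  have h : W.map (fun ω => G (idx ω)) = (W.map idx).map G := (Measure.map_map hG hidx).symm
  rw [h, ← Measure.sum_smul_dirac (W.map idx), Measure.map_sum hG.aemeasurable]
  congr 1
  funext i
  rw [Measure.map_smul, Measure.map_dirac' hG, Measure.map_apply hidx (measurableSet_singleton i)]
  split_ifs with hi
  · rw [hm i hi]
  · have : W (idx ⁻¹' {i}) = 0 := by
      refine measure_mono_null (t := {ω | ok (idx ω)}ᶜ) (fun ω hω h => hi ?_) hok
      rw [← show idx ω = i from hω]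
      exact h
    rw [this, zero_smul]

variable {d : ℕ}

/-- Multi-index of the half-open cell of side `h` containing `x`. -/
def cellIdx (h : ℝ) (x : Euc d) : Fin d → ℤ := fun k => ⌊x k / h⌋

/-- Lower corner of the half-open cell of side `h` containing `x`. -/
def quant (h : ℝ) (x : Euc d) : Euc d :=
  (EuclideanSpace.equiv (Fin d) ℝ).symm fun k => h * cellIdx h x k

theorem measurable_cellIdx (h : ℝ) : Measurable (cellIdx h : Euc d → Fin d → ℤ) := by
  refine measurable_pi_lambda _ fun k => Int.measurable_floor.comp ?_
  exact ((EuclideanSpace.proj k : Euc d →L[ℝ] ℝ).measurable).div_const h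

theorem measurable_quant (h : ℝ) : Measurable (quant h : Euc d → Euc d) :=
  ((EuclideanSpace.equiv (Fin d) ℝ).symm.continuous.measurable).comp <|
    (measurable_of_countable fun (i : Fin d → ℤ) k => h * (i k : ℝ)).comp (measurable_cellIdx h)

theorem cellIdx_eq_iff {h : ℝ} (hh : 0 < h) (x : Euc d) (i : Fin d → ℤ) :
    cellIdx h x = i ↔ ∀ k, h * i k ≤ x k ∧ x k < h * i k + h := by
  rw [funext_iff]
  refine forall_congr' fun k => ?_
  rw [cellIdx, Int.floor_eq_iff, le_div_iff₀ hh, div_lt_iff₀ hh, mul_comm, add_mul, one_mul,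
    mul_comm h]

theorem norm_quant_sub_le {h : ℝ} (hh : 0 < h) (x : Euc d) : ‖quant h x - x‖ ≤ d * h := by
  have hk : ∀ k, ‖(quant h x - x) k‖ ≤ h := fun k => by
    have := (cellIdx_eq_iff hh x _).1 rfl k
    change |h * cellIdx h x k - x k| ≤ h
    rw [abs_le]
    constructor <;> linarith
  calc ‖quant h x - x‖ = ‖∑ k, (quant h x - x) k • EuclideanSpace.basisFun (Fin d) ℝ k‖ := by
        conv_lhs => rw [← (EuclideanSpace.basisFun (Fin d) ℝ).sum_repr (quant h x - x)]
        rfl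
    _ ≤ ∑ k : Fin d, h := by
        refine norm_sum_le_of_le _ fun k _ => ?_
        rw [norm_smul, OrthonormalBasis.norm_eq_one, mul_one]
        exact hk k
    _ = d * h := by simp

theorem abs_mul_cellIdx_le {h : ℝ} (hh : 0 < h) (x : Euc d) (k : Fin d) :
    |h * cellIdx h x k| ≤ ‖x‖ + h := by
  have h₁ := (cellIdx_eq_iff hh x _).1 rfl k
  have h₂ := abs_le.1 (PiLp.norm_apply_le x k)
  rw [abs_le]
  constructor <;> linarith

theorem cellIdx_gxE {T : ℝ} {N : ℕ} (hh : 0 < T / (N : ℝ) ^ 2) (i : Fin d → ℤ) :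
    cellIdx (T / (N : ℝ) ^ 2) (gxE T N i) = i := by
  rw [cellIdx_eq_iff hh]
  exact fun k => ⟨le_rfl, lt_add_of_pos_right _ hh⟩

theorem gxE_add_smul_gvE {T : ℝ} {N : ℕ} (hN : 0 < N) (i j : Fin d → ℤ) :
    gxE T N i + (T / N) • gvE N j = gxE T N (i + j) := by
  ext k
  change T / (N : ℝ) ^ 2 * i k + T / N * (1 / N * j k) = T / (N : ℝ) ^ 2 * ((i + j) k : ℤ)
  have : (N : ℝ) ≠ 0 := by positivity
  push_cast [Pi.add_apply]
  field_simp

/-- The space discretization operator is the push-forward under `quant`. -/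
theorem Ax_eq_map {T : ℝ} {N : ℕ} (hh : 0 < T / (N : ℝ) ^ 2) {μ : Measure (Euc d)}
    {r : ℝ} (hμ : ∀ᵐ x ∂μ, ‖x‖ ≤ r) (hr : r + T / (N : ℝ) ^ 2 ≤ N) :
    Ax T N μ = μ.map (quant (T / (N : ℝ) ^ 2)) := by
  refine sum_dirac_eq_map (measurable_cellIdx _) (gxE T N) ?_ fun i _ => ?_
  · filter_upwards [hμ] with x hx k
    exact (abs_mul_cellIdx_le hh x k).trans (by linarith)
  · refine congrArg μ (ext fun x => ?_)
    exact (cellIdx_eq_iff hh x i).symm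

/-- One step of the lattice scheme, applied to a fibred measure `W`. -/
def latticeStep (T : ℝ) (N : ℕ) (s : ℝ) (W : Measure (Euc d × Euc d)) : Measure (Euc d) :=
  Measure.sum fun ij : (Fin d → ℤ) × (Fin d → ℤ) =>
    if okX T N ij.1 ∧ okV T N ij.2 then
      mvc T N W ij.1 ij.2 • Measure.dirac (gxE T N ij.1 + s • gvE N ij.2)
    else 0

/-- On measures carried by the lattice, a lattice step only rounds the velocities. -/
theorem latticeStep_eq_map {T : ℝ} {N : ℕ} (hT : 0 < T) (hN : 0 < N) (s : ℝ)
    {W : Measure (Euc d × Euc d)} {r m : ℝ} (hgrid : ∀ᵐ p ∂W, p.1 ∈ range (gxE (d := d) T N))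
    (hx : ∀ᵐ p ∂W, ‖p.1‖ ≤ r) (hr : r ≤ N) (hv : ∀ᵐ p ∂W, ‖p.2‖ ≤ m) (hm : m + 1 / N ≤ T * N) :
    latticeStep T N s W = W.map fun p => p.1 + s • quant (1 / N) p.2 := by
  have hN' : (0 : ℝ) < N := by positivity
  have hX : 0 < T / (N : ℝ) ^ 2 := by positivity
  have hV : (0 : ℝ) < 1 / N := by positivity
  have hidx : Measurable fun p : Euc d × Euc d =>
      (cellIdx (T / (N : ℝ) ^ 2) p.1, cellIdx (1 / (N : ℝ)) p.2) :=
    ((measurable_cellIdx _).comp measurable_fst).prodMk ((measurable_cellIdx _).comp measurable_snd)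
  refine (sum_dirac_eq_map (W := W) hidx (fun ij => gxE T N ij.1 + s • gvE N ij.2) ?_ ?_).trans ?_
  · filter_upwards [hgrid, hx, hv] with p ⟨i, hi⟩ hpx hpv
    refine ⟨fun k => ?_, fun k => (abs_mul_cellIdx_le hV p.2 k).trans (by linarith)⟩
    have hik : gx T N (cellIdx (T / (N : ℝ) ^ 2) p.1) k = p.1 k := by
      rw [← hi, cellIdx_gxE hX]; rfl
    rw [hik]
    exact (PiLp.norm_apply_le p.1 k).trans (hpx.trans hr)
  · rintro ⟨i, j⟩ -
    refine measure_congr ?_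
    filter_upwards [hgrid] with p ⟨i', hi'⟩
    refine propext ?_
    change (p.1 = gxE T N i ∧ ∀ k, gv N j k ≤ p.2 k ∧ p.2 k < gv N j k + 1 / N) ↔
      (cellIdx (T / (N : ℝ) ^ 2) p.1, cellIdx (1 / (N : ℝ)) p.2) = (i, j)
    rw [Prod.mk.injEq, cellIdx_eq_iff hV, ← hi', cellIdx_gxE hX]
    refine and_congr_left' ⟨fun h => ?_, fun h => h ▸ rfl⟩
    rw [← cellIdx_gxE hX i', h, cellIdx_gxE hX]
  · refine Measure.map_congr ?_
    filter_upwards [hgrid] with p ⟨i, hi⟩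
    rw [← hi]
    change gxE T N (cellIdx (T / (N : ℝ) ^ 2) (gxE T N i)) + _ = _
    rw [cellIdx_gxE hX]
    rfl

end Lattice

section Step

variable {d : ℕ}

theorem msupp_eq_support {X : Type*} [TopologicalSpace X] [MeasurableSpace X] (μ : Measure X) :
    msupp μ = μ.support := by
  rw [Measure.support_eq_forall_isOpen]
  ext x
  exact ⟨fun h U hx hU => h U hU hx, fun h U hU hx => h U hx hU⟩

theorem norm_le_of_mem_msupp {μ : Measure (Euc d)} {r : ℝ} (hμ : ∀ᵐ x ∂μ, ‖x‖ ≤ r) {x : Euc d}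
    (hx : x ∈ msupp μ) : ‖x‖ ≤ r := by
  rw [msupp_eq_support] at hx
  have h : closedBall (0 : Euc d) r ∈ ae μ := hμ.mono fun y hy => mem_closedBall_zero_iff.2 hy
  exact mem_closedBall_zero_iff.1 (Measure.support_subset_of_isClosed isClosed_closedBall h hx)

theorem Pc_of_ae_norm_le {μ : Measure (Euc d)} [hp : IsProbabilityMeasure μ] {r : ℝ}
    (hμ : ∀ᵐ x ∂μ, ‖x‖ ≤ r) : Pc μ :=
  ⟨hp, closedBall 0 r, isCompact_closedBall _ _,
    hμ.mono fun _ hy => mem_closedBall_zero_iff.2 hy⟩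

theorem exists_ae_norm_le_of_Pc {μ : Measure (Euc d)} (hμ : Pc μ) :
    ∃ r, 0 ≤ r ∧ ∀ᵐ x ∂μ, ‖x‖ ≤ r := by
  obtain ⟨-, K, hK, hK0⟩ := hμ
  obtain ⟨r, hr⟩ := hK.isBounded.exists_norm_le
  refine ⟨max r 0, le_max_right _ _, ?_⟩
  have h : ∀ᵐ x ∂μ, x ∈ K := hK0
  exact h.mono fun x hx => (hr x hx).trans (le_max_left _ _)

variable {V : Measure (Euc d) → Measure (Euc d × Euc d)} {C L r : ℝ}

/-- Under (H1), the velocities charged by `V μ` are bounded in terms of the radius of `μ`. -/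
theorem ae_norm_snd_le (h1 : H1cond C V) (hC : 0 ≤ C) (hr : 0 ≤ r) {μ : Measure (Euc d)}
    [IsProbabilityMeasure μ] (hμ : ∀ᵐ x ∂μ, ‖x‖ ≤ r) : ∀ᵐ p ∂V μ, ‖p.2‖ ≤ C * (1 + r) := by
  have hsup : ⨆ x : msupp μ, ‖(x : Euc d)‖ ≤ r :=
    Real.iSup_le (fun x => norm_le_of_mem_msupp hμ x.2) hr
  filter_upwards [Measure.support_mem_ae (μ := V μ)] with p hp
  exact (h1 μ (Pc_of_ae_norm_le hμ) p (by rwa [msupp_eq_support])).trans (by gcongr)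

/-- Under (H3), the fibred measures admit a plan that is optimal between the bases and almost
optimal between the fibres. -/
theorem exists_fibre_coupling (hV : IsPVF V)
    (hLip : ∀ μ ν : Measure (Euc d), Pc μ → Pc ν → msupp μ ⊆ ball (0 : Euc d) (r + 1) →
      msupp ν ⊆ ball (0 : Euc d) (r + 1) → Wfib (V μ) (V ν) ≤ L * W1 μ ν) (hL : 0 ≤ L)
    {μ ν : Measure (Euc d)} [IsProbabilityMeasure μ] [IsProbabilityMeasure ν]
    (hμ : ∀ᵐ x ∂μ, ‖x‖ ≤ r) (hν : ∀ᵐ x ∂ν, ‖x‖ ≤ r) {η : ℝ} (hη : 0 < η) :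
    ∃ P ∈ Couplings (V μ) (V ν), ∫ q, dist q.1.1 q.2.1 ∂P = Wplan μ ν ∧
      ∫ q, ‖q.1.2 - q.2.2‖ ∂P ≤ L * Wplan μ ν + η := by
  obtain ⟨_, hVμ⟩ := hV μ ‹_›
  obtain ⟨_, hVν⟩ := hV ν ‹_›
  obtain ⟨π, hπ⟩ := exists_mem_optCouplings hμ hν
  have hsub : ∀ {ρ : Measure (Euc d)}, (∀ᵐ x ∂ρ, ‖x‖ ≤ r) → msupp ρ ⊆ ball (0 : Euc d) (r + 1) :=
    fun hρ x hx => mem_ball_zero_iff.2 ((norm_le_of_mem_msupp hρ hx).trans_lt (lt_add_one r))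
  have hfib : Wfib (V μ) (V ν) < L * Wplan μ ν + η := by
    have h := hLip μ ν (Pc_of_ae_norm_le hμ) (Pc_of_ae_norm_le hν) (hsub hμ) (hsub hν)
    have := mul_le_mul_of_nonneg_left (W1_le_Wplan hμ hν) hL
    linarith
  obtain ⟨P₀, hP₀, hP₀π⟩ := exists_coupling_lift (V μ) (V ν) π (by rw [hVμ, hVν]; exact hπ.1)
  have hP₀opt : P₀.map (fun q => (q.1.1, q.2.1)) ∈
      OptCouplings ((V μ).map Prod.fst) ((V ν).map Prod.fst) := by
    rw [hP₀π, hVμ, hVν]; exact hπ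
  have hne : {P : Measure ((Euc d × Euc d) × (Euc d × Euc d)) | P ∈ Couplings (V μ) (V ν) ∧
      P.map (fun q => (q.1.1, q.2.1)) ∈
        OptCouplings ((V μ).map Prod.fst) ((V ν).map Prod.fst)}.Nonempty := ⟨P₀, hP₀, hP₀opt⟩
  obtain ⟨_, ⟨P, ⟨hP, hPopt⟩, rfl⟩, hlt⟩ := exists_lt_of_csInf_lt (hne.image _) hfib
  refine ⟨P, hP, ?_, hlt.le⟩
  rw [hVμ, hVν] at hPopt
  rw [← hPopt.2, integral_map (by fun_prop) measurable_dist.aestronglyMeasurable]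

/-- One step of the Lagrangian scheme. -/
def lagrangianStep (s : ℝ) (W : Measure (Euc d × Euc d)) : Measure (Euc d) :=
  W.map fun p => p.1 + s • p.2

/-- `μ` is a probability measure concentrated on the closed ball of radius `r`. -/
structure ConcentratedOn (r : ℝ) (μ : Measure (Euc d)) : Prop where
  isProb : IsProbabilityMeasure μ
  ae_norm_le : ∀ᵐ x ∂μ, ‖x‖ ≤ r

theorem ConcentratedOn.map {Ω : Type*} [MeasurableSpace Ω] {W : Measure Ω}
    [IsProbabilityMeasure W] {F : Ω → Euc d} (hF : Measurable F) (h : ∀ᵐ ω ∂W, ‖F ω‖ ≤ r) :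
    ConcentratedOn r (W.map F) :=
  ⟨Measure.isProbabilityMeasure_map hF.aemeasurable,
    (ae_map_iff hF.aemeasurable (measurableSet_le measurable_norm measurable_const)).2 h⟩

theorem measurableSet_range_gxE (T : ℝ) (N : ℕ) : MeasurableSet (range (gxE (d := d) T N)) :=
  (countable_range _).measurableSet

theorem measurable_add_smul_quant (s h : ℝ) :
    Measurable fun p : Euc d × Euc d => p.1 + s • quant h p.2 :=
  measurable_fst.add (((measurable_quant h).comp measurable_snd).const_smul s)

/-- Comparison of one step of the lattice scheme with one step of the Lagrangian scheme. -/
theorem latticeStep_lagrangianStep (hV : IsPVF V) (h1 : H1cond C V) (hC : 0 ≤ C) {R : ℝ}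
    (hLip : ∀ μ ν : Measure (Euc d), Pc μ → Pc ν → msupp μ ⊆ ball (0 : Euc d) (R + 1) →
      msupp ν ⊆ ball (0 : Euc d) (R + 1) → Wfib (V μ) (V ν) ≤ L * W1 μ ν) (hL : 0 ≤ L)
    (hr : 0 ≤ r) (hrR : r ≤ R) {T : ℝ} {N : ℕ} (hT : 0 < T) (hN : 0 < N) (hRN : R ≤ N)
    (hvel : C * (1 + R) + 1 / N ≤ T * N) (hdC : d * (1 / N : ℝ) ≤ C) {μ ν : Measure (Euc d)}
    (hμ : ConcentratedOn r μ) (hν : ConcentratedOn r ν) (hgrid : ∀ᵐ x ∂μ, x ∈ range (gxE T N))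
    {s : ℝ} (hs : 0 ≤ s) :
    ConcentratedOn (r + s * (C * (2 + r))) (latticeStep T N s (V μ)) ∧
    ConcentratedOn (r + s * (C * (2 + r))) (lagrangianStep s (V ν)) ∧
    (s = T / N → ∀ᵐ x ∂latticeStep T N s (V μ), x ∈ range (gxE T N)) ∧
    Wplan (latticeStep T N s (V μ)) (lagrangianStep s (V ν)) ≤
      (1 + s * L) * Wplan μ ν + s * ((d + 1) * (1 / N)) := by
  have hh : (0 : ℝ) < 1 / N := by positivity
  have := hμ.isProb
  have := hν.isProb
  have hμr := hμ.ae_norm_le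
  have hνr := hν.ae_norm_le
  obtain ⟨_, hVμ⟩ := hV μ ‹_›
  obtain ⟨_, hVν⟩ := hV ν ‹_›
  have hxμ : ∀ᵐ p ∂V μ, ‖p.1‖ ≤ r := ae_fst_of_map hVμ hμr
  have hxν : ∀ᵐ p ∂V ν, ‖p.1‖ ≤ r := ae_fst_of_map hVν hνr
  have hvμ := ae_norm_snd_le h1 hC hr hμr
  have hvν := ae_norm_snd_le h1 hC hr hνr
  have hgμ : ∀ᵐ p ∂V μ, p.1 ∈ range (gxE (d := d) T N) := ae_fst_of_map hVμ hgrid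
  have hvle : C * (1 + r) + 1 / N ≤ T * N := by
    have : C * (1 + r) ≤ C * (1 + R) := by gcongr
    linarith
  have hmap := latticeStep_eq_map hT hN s hgμ hxμ (hrR.trans hRN) hvμ hvle
  have hF := measurable_add_smul_quant (d := d) s (1 / N)
  have hG : Measurable fun p : Euc d × Euc d => p.1 + s • p.2 := by fun_prop
  have hq := fun v : Euc d => norm_quant_sub_le hh v
  rw [hmap]
  refine ⟨.map hF ?_, .map hG ?_, ?_, ?_⟩
  · filter_upwards [hxμ, hvμ] with p hx hv
    have h₁ := norm_le_norm_add_norm_sub' (quant (1 / N) p.2) p.2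
    have h₂ : ‖quant (1 / N) p.2‖ ≤ C * (2 + r) := by linarith [hq p.2]
    calc ‖p.1 + s • quant (1 / N) p.2‖ ≤ ‖p.1‖ + s * ‖quant (1 / N) p.2‖ := by
          refine (norm_add_le _ _).trans_eq ?_
          rw [norm_smul, Real.norm_of_nonneg hs]
      _ ≤ r + s * (C * (2 + r)) := by gcongr
  · filter_upwards [hxν, hvν] with p hx hv
    have h₂ : ‖p.2‖ ≤ C * (2 + r) := by linarith
    calc ‖p.1 + s • p.2‖ ≤ ‖p.1‖ + s * ‖p.2‖ := by
          refine (norm_add_le _ _).trans_eq ?_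
          rw [norm_smul, Real.norm_of_nonneg hs]
      _ ≤ r + s * (C * (2 + r)) := by gcongr
  · rintro rfl
    refine (ae_map_iff hF.aemeasurable (measurableSet_range_gxE T N)).2 ?_
    filter_upwards [hgμ] with p ⟨i, hi⟩
    exact ⟨i + cellIdx (1 / N) p.2, by rw [← gxE_add_smul_gvE hN, hi]; rfl⟩
  · obtain ⟨P, ⟨hP₁, hP₂⟩, hbase, hfib⟩ := exists_fibre_coupling (r := R) hV hLip hL
      (hμr.mono fun _ h => h.trans hrR) (hνr.mono fun _ h => h.trans hrR) hh
    have := isProbabilityMeasure_of_map_fst hP₁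
    have i₁ : Integrable (fun q : (Euc d × Euc d) × (Euc d × Euc d) => dist q.1.1 q.2.1) P := by
      refine .of_bound (by fun_prop) (r + r) ?_
      filter_upwards [ae_fst_of_map hP₁ hxμ, ae_snd_of_map hP₂ hxν] with q h h'
      rw [Real.norm_of_nonneg dist_nonneg]
      exact (dist_le_norm_add_norm _ _).trans (add_le_add h h')
    have i₂ : Integrable (fun q : (Euc d × Euc d) × (Euc d × Euc d) => ‖q.1.2 - q.2.2‖) P := by
      refine .of_bound (by fun_prop) (C * (1 + r) + C * (1 + r)) ?_
      filter_upwards [ae_fst_of_map hP₁ hvμ, ae_snd_of_map hP₂ hvν] with q h h'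
      rw [norm_norm]
      exact (norm_sub_le _ _).trans (add_le_add h h')
    calc Wplan ((V μ).map fun p => p.1 + s • quant (1 / N) p.2) (lagrangianStep s (V ν))
        = Wplan (P.map fun q => q.1.1 + s • quant (1 / N) q.1.2)
            (P.map fun q => q.2.1 + s • q.2.2) := by
          rw [lagrangianStep, ← hP₁, ← hP₂, Measure.map_map hF measurable_fst,
            Measure.map_map hG measurable_snd]
          rfl
      _ ≤ ∫ q, dist (q.1.1 + s • quant (1 / N) q.1.2) (q.2.1 + s • q.2.2) ∂P :=
          Wplan_map_le P (hF.comp measurable_fst) (hG.comp measurable_snd)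
      _ ≤ ∫ q, (dist q.1.1 q.2.1 + s * ‖q.1.2 - q.2.2‖ + s * (d * (1 / N))) ∂P := by
          refine integral_mono_of_nonneg (.of_forall fun _ => dist_nonneg)
            ((i₁.add (i₂.const_mul s)).add (integrable_const _)) (.of_forall fun q => ?_)
          have e : q.1.1 + s • quant (1 / (N : ℝ)) q.1.2 - (q.2.1 + s • q.2.2) =
              (q.1.1 - q.2.1) + s • ((quant (1 / (N : ℝ)) q.1.2 - q.1.2) + (q.1.2 - q.2.2)) := by
            module
          change dist _ _ ≤ dist q.1.1 q.2.1 + s * ‖q.1.2 - q.2.2‖ + s * (d * (1 / N))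
          rw [dist_eq_norm, e, dist_eq_norm]
          refine (norm_add_le _ _).trans ?_
          rw [norm_smul, Real.norm_of_nonneg hs, add_assoc, ← mul_add]
          gcongr
          refine (norm_add_le _ _).trans ?_
          linarith [hq q.1.2]
      _ = ∫ q, dist q.1.1 q.2.1 ∂P + s * ∫ q, ‖q.1.2 - q.2.2‖ ∂P + s * (d * (1 / N)) := by
          have h := integral_add (i₁.add (i₂.const_mul s))
            (integrable_const (μ := P) (s * (d * (1 / (N : ℝ)))))
          simp only [Pi.add_apply] at h
          rw [h, integral_add i₁ (i₂.const_mul s), integral_const_mul]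
          simp
      _ ≤ (1 + s * L) * Wplan μ ν + s * ((d + 1) * (1 / N)) := by
          have := mul_le_mul_of_nonneg_left hfib hs
          rw [hbase]
          linarith

end Step

section Iteration

variable {d : ℕ} {V : Measure (Euc d) → Measure (Euc d × Euc d)} {C L r R T : ℝ} {N : ℕ}
  {μ₀ : Measure (Euc d)}

theorem one_add_div_mul_pow_le_exp (hT : 0 ≤ T) (hL : 0 ≤ L) (hN : 0 < N) {k : ℕ} (hk : k ≤ N) :
    (1 + T / N * L) ^ k ≤ Real.exp (L * T) := by
  have hN' : (0 : ℝ) < N := by positivity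
  have hk' : (k : ℝ) ≤ N := by exact_mod_cast hk
  calc (1 + T / N * L) ^ k ≤ Real.exp (T / N * L) ^ k := by
        refine pow_le_pow_left₀ (by positivity) ?_ k
        rw [add_comm]
        exact Real.add_one_le_exp _
    _ = Real.exp (k * (T / N * L)) := (Real.exp_nat_mul _ _).symm
    _ ≤ Real.exp (N * (T / N * L)) := by gcongr
    _ = Real.exp (L * T) := by congr 1; field_simp

/-- The bound for the distance between the two schemes after `k` steps. -/
def stepError (d : ℕ) (L T : ℝ) (N k : ℕ) : ℝ :=
  (1 + T / N * L) ^ k * (d * (T / (N : ℝ) ^ 2) + k * (T / N * ((d + 1) * (1 / N))))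

theorem stepError_succ_ge (hT : 0 ≤ T) (hL : 0 ≤ L) {s w : ℝ} (k : ℕ) (hs : 0 ≤ s)
    (hsT : s ≤ T / N) (hw : w ≤ stepError d L T N k) :
    (1 + s * L) * w + s * ((d + 1) * (1 / N)) ≤ stepError d L T N (k + 1) := by
  have h₀ : 0 ≤ stepError d L T N k := by unfold stepError; positivity
  have h₁ : 1 ≤ (1 + T / N * L) ^ (k + 1) := one_le_pow₀ (le_add_of_nonneg_right (by positivity))
  calc (1 + s * L) * w + s * ((d + 1) * (1 / N))
      ≤ (1 + s * L) * stepError d L T N k + s * ((d + 1) * (1 / N)) := by gcongr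
    _ ≤ (1 + T / N * L) * stepError d L T N k +
        (1 + T / N * L) ^ (k + 1) * (T / N * ((d + 1) * (1 / N))) := by
      have h₂ : s * ((d + 1) * (1 / N)) ≤ T / N * ((d + 1) * (1 / N)) := by gcongr
      have h₃ : T / N * ((d + 1) * (1 / N)) ≤
          (1 + T / N * L) ^ (k + 1) * (T / N * ((d + 1) * (1 / N))) :=
        le_mul_of_one_le_left (by positivity) h₁
      have h₄ : (1 + s * L) * stepError d L T N k ≤ (1 + T / N * L) * stepError d L T N k := by
        gcongr
      linarith
    _ = stepError d L T N (k + 1) := by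
      unfold stepError
      push_cast
      ring

theorem stepError_le (hT : 0 ≤ T) (hL : 0 ≤ L) (hN : 0 < N) {k : ℕ} (hk : k ≤ N) :
    stepError d L T N k ≤
      Real.exp (L * T) * (d * (T / (N : ℝ) ^ 2) + T * ((d + 1) * (1 / N))) := by
  have hN' : (0 : ℝ) < N := by positivity
  have hk' : (k : ℝ) ≤ N := by exact_mod_cast hk
  have h : k * (T / N * ((d + 1) * (1 / N))) ≤ T * (((d : ℝ) + 1) * (1 / N)) :=
    calc k * (T / N * ((d + 1) * (1 / N))) ≤ N * (T / N * (((d : ℝ) + 1) * (1 / N))) := by gcongr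
      _ = T * ((d + 1) * (1 / N)) := by field_simp
  unfold stepError
  gcongr
  exact one_add_div_mul_pow_le_exp hT hL hN hk

/-- The time step index of `t`, i.e. the `k` with `t ∈ (k T/N, (k+1) T/N]`. -/
theorem stepIndex_spec (hT : 0 < T) (hN : 0 < N) {t : ℝ} (ht : 0 < t) (htT : t ≤ T) :
    ⌈t / (T / N)⌉.toNat - 1 + 1 ≤ N ∧ 0 ≤ t - (↑(⌈t / (T / N)⌉.toNat - 1) : ℝ) * (T / N) ∧
      t - (↑(⌈t / (T / N)⌉.toNat - 1) : ℝ) * (T / N) ≤ T / N := by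
  have hN' : (0 : ℝ) < N := by positivity
  have hΔ : 0 < T / N := by positivity
  have hpos : 0 < ⌈t / (T / N)⌉ := Int.ceil_pos.2 (by positivity)
  have hle : ⌈t / (T / N)⌉ ≤ (N : ℤ) := by
    rw [Int.ceil_le, div_le_iff₀ hΔ]
    push_cast
    rw [mul_div_cancel₀ _ hN'.ne']
    exact htT
  obtain ⟨k, hk⟩ : ∃ k : ℕ, ⌈t / (T / N)⌉ = (k : ℤ) + 1 := ⟨(⌈t / (T / N)⌉ - 1).toNat, by omega⟩
  have hk' : ⌈t / (T / N)⌉.toNat - 1 = k := by omega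
  rw [hk']
  have h₁ := Int.ceil_lt_add_one (t / (T / N))
  have h₂ := Int.le_ceil (t / (T / N))
  rw [hk] at h₁ h₂
  push_cast at h₁ h₂
  have h₃ : (k : ℝ) < t / (T / N) := by linarith
  rw [lt_div_iff₀ hΔ] at h₃
  rw [div_le_iff₀ hΔ] at h₂
  exact ⟨by omega, by linarith, by linarith⟩

theorem LASk_lagrStep_invariant (hV : IsPVF V) (h1 : H1cond C V) (hC : 0 ≤ C)
    (hLip : ∀ μ ν : Measure (Euc d), Pc μ → Pc ν → msupp μ ⊆ ball (0 : Euc d) (R + 1) →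
      msupp ν ⊆ ball (0 : Euc d) (R + 1) → Wfib (V μ) (V ν) ≤ L * W1 μ ν) (hL : 0 ≤ L)
    (hr : 0 ≤ r) (hR : (r + 3) * Real.exp (C * T) ≤ R) (hT : 0 < T) (hN : 0 < N) (hRN : R ≤ N)
    (hvel : C * (1 + R) + 1 / N ≤ T * N) (hdC : d * (1 / N : ℝ) ≤ C)
    (hdx : d * (T / (N : ℝ) ^ 2) ≤ 1) (hrx : r + T / (N : ℝ) ^ 2 ≤ N)
    (hμ₀ : ConcentratedOn r μ₀) {k : ℕ} (hk : k ≤ N) :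
    ConcentratedOn ((r + 3) * (1 + T / N * C) ^ k - 2) (LASk T N V μ₀ k) ∧
    ConcentratedOn ((r + 3) * (1 + T / N * C) ^ k - 2) (lagrStep T N V μ₀ k) ∧
    (∀ᵐ x ∂LASk T N V μ₀ k, x ∈ range (gxE T N)) ∧
    Wplan (LASk T N V μ₀ k) (lagrStep T N V μ₀ k) ≤ stepError d L T N k := by
  have hN' : (0 : ℝ) < N := by positivity
  have hh : 0 < T / (N : ℝ) ^ 2 := by positivity
  induction k with
  | zero =>
    have := hμ₀.isProb
    have hq := measurable_quant (d := d) (T / (N : ℝ) ^ 2)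
    have hAx : LASk T N V μ₀ 0 = μ₀.map (quant (T / (N : ℝ) ^ 2)) :=
      Ax_eq_map hh hμ₀.ae_norm_le hrx
    rw [hAx, pow_zero, mul_one]
    refine ⟨.map hq ?_, ⟨this, hμ₀.ae_norm_le.mono fun x hx => by linarith⟩, ?_, ?_⟩
    · filter_upwards [hμ₀.ae_norm_le] with x hx
      have h₁ := norm_le_norm_add_norm_sub' (quant (T / (N : ℝ) ^ 2) x) x
      linarith [norm_quant_sub_le hh x]
    · exact (ae_map_iff hq.aemeasurable (measurableSet_range_gxE T N)).2
        (.of_forall fun x => ⟨cellIdx _ x, rfl⟩)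
    · calc Wplan (μ₀.map (quant (T / (N : ℝ) ^ 2))) μ₀
          = Wplan (μ₀.map (quant (T / (N : ℝ) ^ 2))) (μ₀.map id) := by rw [Measure.map_id]
        _ ≤ ∫ x, dist (quant (T / (N : ℝ) ^ 2) x) (id x) ∂μ₀ := Wplan_map_le μ₀ hq measurable_id
        _ ≤ ∫ _, d * (T / (N : ℝ) ^ 2) ∂μ₀ := by
          refine integral_mono_of_nonneg (.of_forall fun _ => dist_nonneg) (integrable_const _)
            (.of_forall fun x => ?_)
          exact (dist_eq_norm _ _).trans_le (norm_quant_sub_le hh x)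
        _ = stepError d L T N 0 := by simp [stepError]
  | succ k ih =>
    obtain ⟨hμ, hν, hgrid, hW⟩ := ih (Nat.le_of_succ_le hk)
    have hpow : 1 ≤ (1 + T / N * C) ^ k := one_le_pow₀ (le_add_of_nonneg_right (by positivity))
    have hpow' := one_add_div_mul_pow_le_exp hT.le hC hN (Nat.le_of_succ_le hk)
    have hr₀ : 0 ≤ (r + 3) * (1 + T / N * C) ^ k - 2 := by nlinarith
    have hrR : (r + 3) * (1 + T / N * C) ^ k - 2 ≤ R := by
      have : (r + 3) * (1 + T / N * C) ^ k ≤ (r + 3) * Real.exp (C * T) := by gcongr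
      linarith
    obtain ⟨h₁, h₂, h₃, h₄⟩ := latticeStep_lagrangianStep hV h1 hC hLip hL hr₀ hrR hT hN hRN hvel
      hdC hμ hν hgrid (s := T / N) (by positivity)
    have hrad : (r + 3) * (1 + T / N * C) ^ k - 2 +
        T / N * (C * (2 + ((r + 3) * (1 + T / N * C) ^ k - 2))) =
        (r + 3) * (1 + T / N * C) ^ (k + 1) - 2 := by ring
    rw [hrad] at h₁ h₂
    exact ⟨h₁, h₂, h₃ rfl, h₄.trans (stepError_succ_ge hT.le hL k (by positivity) le_rfl hW)⟩

/-- Explicit estimate for the distance between the two schemes on `[0, T]`. -/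
theorem W1_LAS_lagrT_le (hV : IsPVF V) (h1 : H1cond C V) (hC : 0 ≤ C)
    (hLip : ∀ μ ν : Measure (Euc d), Pc μ → Pc ν → msupp μ ⊆ ball (0 : Euc d) (R + 1) →
      msupp ν ⊆ ball (0 : Euc d) (R + 1) → Wfib (V μ) (V ν) ≤ L * W1 μ ν) (hL : 0 ≤ L)
    (hr : 0 ≤ r) (hR : (r + 3) * Real.exp (C * T) ≤ R) (hT : 0 < T) (hN : 0 < N) (hRN : R ≤ N)
    (hvel : C * (1 + R) + 1 / N ≤ T * N) (hdC : d * (1 / N : ℝ) ≤ C)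
    (hdx : d * (T / (N : ℝ) ^ 2) ≤ 1) (hrx : r + T / (N : ℝ) ^ 2 ≤ N)
    (hμ₀ : ConcentratedOn r μ₀) {t : ℝ} (ht : t ≤ T) :
    W1 (LAS T N V μ₀ t) (lagrT T N V μ₀ t) ≤
      Real.exp (L * T) * (d * (T / (N : ℝ) ^ 2) + T * ((d + 1) * (1 / N))) := by
  have hinv {k : ℕ} (hk : k ≤ N) := LASk_lagrStep_invariant hV h1 hC hLip hL hr hR hT hN hRN hvel
    hdC hdx hrx hμ₀ hk
  have hW1 {ρ : ℝ} {μ ν : Measure (Euc d)} (hμ : ConcentratedOn ρ μ) (hν : ConcentratedOn ρ ν) :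
      W1 μ ν ≤ Wplan μ ν := by
    have := hμ.isProb
    have := hν.isProb
    exact W1_le_Wplan hμ.ae_norm_le hν.ae_norm_le
  rcases le_or_gt t 0 with ht₀ | ht₀
  · obtain ⟨hμ, hν, -, hW⟩ := hinv (Nat.zero_le N)
    rw [LAS, lagrT, if_pos ht₀, if_pos ht₀]
    exact (hW1 hμ hν).trans (hW.trans (stepError_le hT.le hL hN (Nat.zero_le N)))
  · obtain ⟨hk, hs, hsT⟩ := stepIndex_spec hT hN ht₀ ht
    rw [LAS, lagrT, if_neg ht₀.not_ge, if_neg ht₀.not_ge]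
    generalize ⌈t / (T / N)⌉.toNat - 1 = k at *
    obtain ⟨hμ, hν, hgrid, hW⟩ := hinv (Nat.le_of_succ_le hk)
    have hpow : 1 ≤ (1 + T / N * C) ^ k := one_le_pow₀ (le_add_of_nonneg_right (by positivity))
    have hpow' := one_add_div_mul_pow_le_exp hT.le hC hN (Nat.le_of_succ_le hk)
    have hr₀ : 0 ≤ (r + 3) * (1 + T / N * C) ^ k - 2 := by nlinarith
    have hrR : (r + 3) * (1 + T / N * C) ^ k - 2 ≤ R := by
      have : (r + 3) * (1 + T / N * C) ^ k ≤ (r + 3) * Real.exp (C * T) := by gcongr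
      linarith
    obtain ⟨h₁, h₂, -, h₄⟩ := latticeStep_lagrangianStep hV h1 hC hLip hL hr₀ hrR hT hN hRN hvel
      hdC hμ hν hgrid hs
    exact (hW1 h₁ h₂).trans <| h₄.trans <| (stepError_succ_ge hT.le hL k hs hsT hW).trans <|
      stepError_le hT.le hL hN hk

end Iteration

/-- quantitative closeness of the LAS and the semi-discrete Lagrangian
scheme: `sup_{t ∈ [0,T]} W(μ^N_t, μ̄^N_t) → 0` as `N → ∞`. -/
theorem LAS_lagrangian_close {d : ℕ} (T : ℝ) (hT : 0 < T)
    (V : Measure (Euc d) → Measure (Euc d × Euc d)) (hV : IsPVF V)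
    (h1 : H1 V) (h3 : H3 V)
    (μ₀ : Measure (Euc d)) (hμ₀ : Pc μ₀) :
    ∀ ε > 0, ∃ K : ℕ, ∀ N ≥ K, ∀ t ∈ Icc (0 : ℝ) T,
      W1 (LAS T N V μ₀ t) (lagrT T N V μ₀ t) < ε := by
  intro ε hε
  obtain ⟨C, hC, h1C⟩ := h1
  obtain ⟨r, hr, hμr⟩ := exists_ae_norm_le_of_Pc hμ₀
  set R : ℝ := (r + 3) * Real.exp (C * T) with hR
  obtain ⟨L, hL, hLip⟩ := h3 (R + 1) (by positivity)
  have hN : Tendsto (fun N : ℕ => (N : ℝ)) atTop atTop := tendsto_natCast_atTop_atTop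
  have hinv : Tendsto (fun N : ℕ => 1 / (N : ℝ)) atTop (𝓝 0) := tendsto_one_div_atTop_nhds_zero_nat
  have hsq : Tendsto (fun N : ℕ => T / (N : ℝ) ^ 2) atTop (𝓝 0) :=
    tendsto_const_nhds.div_atTop ((tendsto_pow_atTop two_ne_zero).comp hN)
  have hdinv : Tendsto (fun N : ℕ => d * (1 / (N : ℝ))) atTop (𝓝 0) := by
    simpa using hinv.const_mul (d : ℝ)
  have hdsq : Tendsto (fun N : ℕ => d * (T / (N : ℝ) ^ 2)) atTop (𝓝 0) := by
    simpa using hsq.const_mul (d : ℝ)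
  have herr : Tendsto (fun N : ℕ => Real.exp (L * T) *
      (d * (T / (N : ℝ) ^ 2) + T * ((d + 1) * (1 / N)))) atTop (𝓝 0) := by
    simpa using (hdsq.add ((hinv.const_mul ((d : ℝ) + 1)).const_mul T)).const_mul (Real.exp (L * T))
  obtain ⟨K, hK⟩ := eventually_atTop.1 <|
    (eventually_gt_atTop 0).and <| (hN.eventually_ge_atTop R).and <|
    (hinv.eventually_le_const one_pos).and <|
    ((hN.const_mul_atTop hT).eventually_ge_atTop (C * (1 + R) + 1)).and <|
    (hdinv.eventually_le_const hC).and <| (hdsq.eventually_le_const one_pos).and <|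
    (hsq.eventually_le_const one_pos).and <| (hN.eventually_ge_atTop (r + 1)).and <|
    herr.eventually_lt_const hε
  refine ⟨K, fun N hNK t ht => ?_⟩
  obtain ⟨hN₀, hRN, hi, hvel, hdC, hdx, hx, hrN, he⟩ := hK N hNK
  exact (W1_LAS_lagrT_le hV h1C hC.le hLip hL.le hr hR.ge hT hN₀ hRN (by linarith) hdC hdx
    (by linarith) ⟨hμ₀.1, hμr⟩ ht.2).trans_lt he

end
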